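/- Let k ≥ 2 and let P be a finite poset of height h excluding k+k. If every convex subposet Q of P of height at most 4k−4 satisfies dim(Q) ≤ d_1, then dim(P) ≤ (h+1)·d_1. -/

import Mathlib

variable {α : Type*}

/-- A linear extension of a partial order, given as a binary relation. -/
def IsLinExt [PartialOrder α] (r : α → α → Prop) : Prop :=
  IsLinearOrder α r ∧ ∀ x y : α, x ≤ y → r x y

/-- A realizer: a family of linear extensions whose intersection is the order. -/
def IsRealizer [PartialOrder α] {d : ℕ} (L : Fin d → α → α → Prop) : Prop :=
  (∀ i, IsLinExt (L i)) ∧ ∀ x y : α, x ≤ y ↔ ∀ i, L i x y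

/-- The order dimension of a poset: the least positive `d` admitting a realizer of size `d`. -/
noncomputable def pdim (α : Type*) [PartialOrder α] : ℕ :=
  sInf {d | 0 < d ∧ ∃ L : Fin d → α → α → Prop, IsRealizer L}

/-- The set of (ordered) incomparable pairs of a poset. -/
def IncPairs (α : Type*) [PartialOrder α] : Set (α × α) :=
  {p | ¬ p.1 ≤ p.2 ∧ ¬ p.2 ≤ p.1}

/-- `r` reverses every pair `(x, y)` in `S`, i.e. `x > y` in `r`. -/
def Reverses [PartialOrder α] (r : α → α → Prop) (S : Set (α × α)) : Prop :=
  ∀ p ∈ S, r p.2 p.1 ∧ ¬ r p.1 p.2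

/-- A set of incomparable pairs is reversible if some linear extension reverses all of them. -/
def Reversible [PartialOrder α] (S : Set (α × α)) : Prop :=
  ∃ r, IsLinExt r ∧ Reverses r S

/-- `d` linear extensions suffice to reverse every pair of `S` (i.e. `dim S ≤ d`). -/
def RealizerOn [PartialOrder α] (d : ℕ) (S : Set (α × α)) : Prop :=
  ∃ L : Fin d → α → α → Prop, (∀ i, IsLinExt (L i)) ∧
    ∀ p ∈ S, ∃ i, L i p.2 p.1 ∧ ¬ L i p.1 p.2

/-- The height of a subset of a poset: the maximum size of a chain contained in it. -/
noncomputable def heightSet [PartialOrder α] (S : Set α) : ℕ :=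
  sSup {n | ∃ t : Finset α, ↑t ⊆ S ∧ IsChain (· ≤ ·) (↑t : Set α) ∧ t.card = n}

/-- The height of a poset: the maximum size of a chain. -/
noncomputable def pheight (α : Type*) [PartialOrder α] : ℕ :=
  heightSet (Set.univ : Set α)

/-- The poset `k + k`: the disjoint sum of two `k`-element chains. -/
def TwoChains (k : ℕ) : Type := Fin k ⊕ Fin k

def TwoChains.le {k : ℕ} : TwoChains k → TwoChains k → Prop
  | .inl i, .inl j => i.1 ≤ j.1
  | .inr i, .inr j => i.1 ≤ j.1
  | _, _ => False

theorem TwoChains.le_refl' {k : ℕ} (x : TwoChains k) : TwoChains.le x x := by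
  cases x <;> simp [TwoChains.le]

theorem TwoChains.le_trans' {k : ℕ} (x y z : TwoChains k)
    (hxy : TwoChains.le x y) (hyz : TwoChains.le y z) : TwoChains.le x z := by
  cases x <;> cases y <;> cases z <;> simp_all [TwoChains.le] <;> omega

theorem TwoChains.le_antisymm' {k : ℕ} (x y : TwoChains k)
    (hxy : TwoChains.le x y) (hyx : TwoChains.le y x) : x = y := by
  cases x <;> cases y <;> simp_all [TwoChains.le] <;>
    exact congrArg _ (le_antisymm hxy hyx)

instance (k : ℕ) : PartialOrder (TwoChains k) where
  le := TwoChains.le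
  le_refl := TwoChains.le_refl'
  le_trans := TwoChains.le_trans'
  le_antisymm := TwoChains.le_antisymm'

/-- A finite chain with at least `n` elements contains an increasing copy of `Fin n`. -/
theorem IsChain.exists_orderEmbedding_fin [PartialOrder α] {t : Finset α}
    (ht : IsChain (· ≤ ·) (t : Set α)) {n : ℕ} (hn : n ≤ t.card) :
    ∃ f : Fin n ↪o α, ∀ i, f i ∈ t := by
  let : LinearOrder t :=
    { (inferInstance : PartialOrder t) with
      le_total := fun a b => ht.total a.2 b.2
      toDecidableLE := Classical.decRel _ }
  let e : Fin t.card ≃o t := Fintype.orderIsoFinOfCardEq t (by simp)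
  exact ⟨((Fin.castLEOrderEmb hn).trans e.toOrderEmbedding).trans (OrderEmbedding.subtype _),
    fun i => (e (Fin.castLE hn i)).2⟩

/-- Two chains of size `k` with no relation between them form a copy of `k + k`. -/
theorem nonempty_twoChains_orderEmbedding [PartialOrder α] {k : ℕ} (f g : Fin k ↪o α)
    (hfg : ∀ i j, ¬ f i ≤ g j ∧ ¬ g j ≤ f i) : Nonempty (TwoChains k ↪o α) := by
  refine ⟨OrderEmbedding.ofMapLEIff (Sum.elim f g : Fin k ⊕ Fin k → α) ?_⟩
  rintro (i | i) (j | j)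
  · exact f.le_iff_le
  · exact iff_of_false (hfg i j).1 id
  · exact iff_of_false (hfg j i).2 id
  · exact g.le_iff_le

theorem card_le_heightSet [PartialOrder α] [Fintype α] {S : Set α} {t : Finset α}
    (htS : (t : Set α) ⊆ S) (ht : IsChain (· ≤ ·) (t : Set α)) : t.card ≤ heightSet S :=
  le_csSup ⟨Fintype.card α, by rintro n ⟨s, -, -, rfl⟩; exact s.card_le_univ⟩ ⟨t, htS, ht, rfl⟩

theorem exists_chain_card_eq_heightSet [PartialOrder α] [Fintype α] (S : Set α) :
    ∃ t : Finset α, (t : Set α) ⊆ S ∧ IsChain (· ≤ ·) (t : Set α) ∧ t.card = heightSet S :=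
  Nat.sSup_mem (s := {n | ∃ t : Finset α, (t : Set α) ⊆ S ∧
    IsChain (· ≤ ·) (t : Set α) ∧ t.card = n}) ⟨0, ∅, by simp⟩
    ⟨Fintype.card α, by rintro n ⟨s, -, -, rfl⟩; exact s.card_le_univ⟩

theorem heightSet_le [PartialOrder α] [Fintype α] {S : Set α} {n : ℕ}
    (h : ∀ t : Finset α, (t : Set α) ⊆ S → IsChain (· ≤ ·) (t : Set α) → t.card ≤ n) :
    heightSet S ≤ n := by
  obtain ⟨t, htS, ht, hc⟩ := exists_chain_card_eq_heightSet S
  exact hc ▸ h t htS ht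

/-- A linear extension of a subposet extends to a linear extension of the whole poset. -/
theorem IsLinExt.exists_extension [PartialOrder α] {Q : Set α} {r : Q → Q → Prop}
    (hr : IsLinExt r) : ∃ s : α → α → Prop, IsLinExt s ∧ ∀ a b : Q, r a b → s a b := by
  obtain ⟨hlin, hle⟩ := hr
  let R : α → α → Prop := fun x y => x ≤ y ∨ ∃ a b : Q, x ≤ a ∧ r a b ∧ (b : α) ≤ y
  have rtrans : ∀ {a b c : Q}, r a b → r b c → r a c := fun h h' => _root_.trans h h'
  have ranti : ∀ {a b : Q}, r a b → r b a → a = b := fun h h' => antisymm h h'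
  have key : ∀ {a b : Q} {x : α}, (a : α) ≤ x → x ≤ b → r a b :=
    fun h h' => hle _ _ (h.trans h')
  have : IsPartialOrder α R :=
    { refl := fun x => Or.inl le_rfl
      trans := by
        rintro x y z (h | ⟨a, b, h1, h2, h3⟩) (h' | ⟨a', b', h1', h2', h3'⟩)
        · exact Or.inl (h.trans h')
        · exact Or.inr ⟨a', b', h.trans h1', h2', h3'⟩
        · exact Or.inr ⟨a, b, h1, h2, h3.trans h'⟩
        · exact Or.inr ⟨a, b', h1, rtrans h2 (rtrans (key h3 h1') h2'), h3'⟩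
      antisymm := by
        rintro x y (h | ⟨a, b, h1, h2, h3⟩) (h' | ⟨a', b', h1', h2', h3'⟩)
        · exact h.antisymm h'
        · obtain rfl := ranti h2' (key h3' (h.trans h1'))
          exact h.antisymm (h1'.trans h3')
        · obtain rfl := ranti h2 (key (h3.trans h') h1)
          exact (h1.trans h3).antisymm h'
        · have hba : r b a := rtrans (key h3 h1') (rtrans h2' (key h3' h1))
          have hba' : r b' a' := rtrans (key h3' h1) (rtrans h2 (key h3 h1'))
          obtain rfl := ranti h2 hba
          obtain rfl := ranti h2' hba'
          exact (h1.trans h3).antisymm (h1'.trans h3') }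
  obtain ⟨s, hs, hRs⟩ := extend_partialOrder R
  exact ⟨s, ⟨hs, fun x y h => hRs _ _ (Or.inl h)⟩,
    fun a b h => hRs _ _ (Or.inr ⟨a, b, le_rfl, h, le_rfl⟩)⟩

theorem exists_isLinExt (α : Type*) [PartialOrder α] : ∃ s : α → α → Prop, IsLinExt s := by
  obtain ⟨s, hs, h⟩ := extend_partialOrder (α := α) (· ≤ ·)
  exact ⟨s, hs, fun x y => h x y⟩

theorem IsLinExt.not_rel [PartialOrder α] {r : α → α → Prop} (hr : IsLinExt r) {x y : α}
    (h : r y x) (hne : x ≠ y) : ¬ r x y :=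
  have := hr.1
  fun h' => hne (antisymm h' h)

/-- Every non-relation `x ≰ y` is witnessed by a linear extension. -/
theorem exists_isLinExt_not_rel [PartialOrder α] {x y : α} (hxy : ¬ x ≤ y) :
    ∃ s : α → α → Prop, IsLinExt s ∧ ¬ s x y := by
  let R : α → α → Prop := fun a b => a ≤ b ∨ (a ≤ y ∧ x ≤ b)
  have : IsPartialOrder α R :=
    { refl := fun a => Or.inl le_rfl
      trans := by
        rintro a b c (h | ⟨h1, h2⟩) (h' | ⟨h1', h2'⟩)
        · exact Or.inl (h.trans h')
        · exact Or.inr ⟨h.trans h1', h2'⟩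
        · exact Or.inr ⟨h1, h2.trans h'⟩
        · exact (hxy (h2.trans h1')).elim
      antisymm := by
        rintro a b (h | ⟨h1, h2⟩) (h' | ⟨h1', h2'⟩)
        · exact h.antisymm h'
        · exact (hxy (h2'.trans (h.trans h1'))).elim
        · exact (hxy (h2.trans (h'.trans h1))).elim
        · exact (hxy (h2.trans h1')).elim }
  obtain ⟨s, hs, hRs⟩ := extend_partialOrder R
  have hlin : IsLinExt s := ⟨hs, fun a b h => hRs _ _ (Or.inl h)⟩
  exact ⟨s, hlin, hlin.not_rel (hRs _ _ (Or.inr ⟨le_rfl, le_rfl⟩)) fun h => hxy h.le⟩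

/-- A family of linear extensions over a finite nonempty type bounds the dimension, provided every
non-relation is witnessed by a member. -/
theorem exists_isRealizer_card [PartialOrder α] {ι : Type*} [Fintype ι]
    (L : ι → α → α → Prop) (hL : ∀ i, IsLinExt (L i))
    (h : ∀ x y : α, ¬ x ≤ y → ∃ i, ¬ L i x y) :
    ∃ M : Fin (Fintype.card ι) → α → α → Prop, IsRealizer M := by
  let e := (Fintype.equivFin ι).symm
  refine ⟨fun i => L (e i), fun i => hL _, fun x y => ⟨fun hxy i => (hL _).2 x y hxy, fun H => ?_⟩⟩
  by_contra hxy
  obtain ⟨i, hi⟩ := h x y hxy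
  exact hi (by simpa using H (e.symm i))

theorem pdim_le_card [PartialOrder α] {ι : Type*} [Fintype ι] [Nonempty ι]
    (L : ι → α → α → Prop) (hL : ∀ i, IsLinExt (L i))
    (h : ∀ x y : α, ¬ x ≤ y → ∃ i, ¬ L i x y) : pdim α ≤ Fintype.card ι :=
  Nat.sInf_le ⟨Fintype.card_pos, exists_isRealizer_card L hL h⟩

/-- The dimension of a finite poset is positive and attained by a realizer. -/
theorem pdim_spec (α : Type*) [PartialOrder α] [Finite α] :
    0 < pdim α ∧ ∃ L : Fin (pdim α) → α → α → Prop, IsRealizer L := by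
  have := Fintype.ofFinite α
  have H : ∀ p : Option (α × α), ∃ s : α → α → Prop, IsLinExt s ∧
      ∀ x y, p = some (x, y) → ¬ x ≤ y → ¬ s x y := by
    rintro (_ | ⟨x, y⟩)
    · obtain ⟨s, hs⟩ := exists_isLinExt α
      exact ⟨s, hs, by simp⟩
    · by_cases hxy : x ≤ y
      · obtain ⟨s, hs⟩ := exists_isLinExt α
        exact ⟨s, hs, by rintro _ _ ⟨⟩ h; exact (h hxy).elim⟩
      · obtain ⟨s, hs, hn⟩ := exists_isLinExt_not_rel hxy
        exact ⟨s, hs, by rintro _ _ ⟨⟩ _; exact hn⟩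
  choose L hL hn using H
  exact Nat.sInf_mem (s := {d | 0 < d ∧ ∃ L : Fin d → α → α → Prop, IsRealizer L})
    ⟨Fintype.card (Option (α × α)), Fintype.card_pos, exists_isRealizer_card L hL
      fun x y hxy => ⟨some (x, y), hn _ x y rfl hxy⟩⟩

/-- If `pdim Q ≤ d`, then `d` linear extensions of the whole poset witness all incomparabilities
within `Q`. -/
theorem exists_isLinExt_of_pdim_le [PartialOrder α] {Q : Set α} [Finite Q] {d : ℕ}
    (hd : pdim Q ≤ d) : ∃ L : Fin d → α → α → Prop, (∀ i, IsLinExt (L i)) ∧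
      ∀ x ∈ Q, ∀ y ∈ Q, ¬ x ≤ y → ∃ i, ¬ L i x y := by
  obtain ⟨hpos, M, hM, hMr⟩ := pdim_spec Q
  choose N hN hMN using fun i => (hM i).exists_extension
  refine ⟨fun i => N (if h : i.1 < pdim Q then ⟨i, h⟩ else ⟨0, hpos⟩), fun i => hN _, ?_⟩
  intro x hx y hy hxy
  have : ¬ ∀ i, M i ⟨x, hx⟩ ⟨y, hy⟩ := fun h => hxy ((hMr ⟨x, hx⟩ ⟨y, hy⟩).2 h)
  push Not at this
  obtain ⟨i, hi⟩ := this
  have := (hM i).1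
  refine ⟨⟨i, i.2.trans_le hd⟩, ?_⟩
  simp only [Fin.is_lt, dif_pos, Fin.eta]
  exact (hN i).not_rel (hMN i _ _ ((total_of (M i) _ _).resolve_left hi)) fun h => hxy h.le

/-- The elements lying neither below the first `i` terms of a chain nor strictly above any of the
remaining terms. -/
def chainSlab [PartialOrder α] {h : ℕ} (c : Fin h ↪o α) (i : ℕ) : Set α :=
  {x | (∀ j : Fin h, j.1 < i → ¬ x ≤ c j) ∧ ∀ j : Fin h, i ≤ j.1 → ¬ c j < x}

theorem ordConnected_chainSlab [PartialOrder α] {h : ℕ} (c : Fin h ↪o α) (i : ℕ) :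
    (chainSlab c i).OrdConnected :=
  ⟨fun _ hx _ hy _ hz => ⟨fun j hj hle => hx.1 j hj (hz.1.trans hle),
    fun j hj hlt => hy.2 j hj (hlt.trans_le hz.2)⟩⟩

open Classical in
/-- Any incomparable pair lies in a common slab. -/
theorem exists_mem_chainSlab [PartialOrder α] {h : ℕ} (c : Fin h ↪o α) {x y : α}
    (hxy : ¬ x ≤ y) (hyx : ¬ y ≤ x) :
    ∃ i ≤ h, x ∈ chainSlab c i ∧ y ∈ chainSlab c i := by
  by_cases hex : ∃ i, ∃ hi : i < h, x ≤ c ⟨i, hi⟩ ∨ y ≤ c ⟨i, hi⟩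
  · obtain ⟨hi, hor⟩ := Nat.find_spec hex
    have hmin : ∀ j : Fin h, j.1 < Nat.find hex → ¬ (x ≤ c j ∨ y ≤ c j) :=
      fun j hj H => Nat.find_min hex hj ⟨j.2, H⟩
    refine ⟨Nat.find hex, hi.le, ⟨fun j hj H => hmin j hj (Or.inl H), fun j hj H => ?_⟩,
      fun j hj H => hmin j hj (Or.inr H), fun j hj H => ?_⟩
    all_goals
      have hc : c ⟨Nat.find hex, hi⟩ ≤ c j := c.monotone hj
      rcases hor with ho | ho
    · exact (ho.trans hc).not_gt H
    · exact hyx ((ho.trans hc).trans H.le)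
    · exact hxy ((ho.trans hc).trans H.le)
    · exact (ho.trans hc).not_gt H
  · push Not at hex
    exact ⟨h, le_rfl, ⟨fun j _ => (hex j j.2).1, fun j hj => absurd j.2 hj.not_gt⟩,
      fun j _ => (hex j j.2).2, fun j hj => absurd j.2 hj.not_gt⟩

open Classical in
/-- In a poset excluding `k + k`, every slab of a maximum chain has height at most `4k - 4`. -/
theorem heightSet_chainSlab_le [PartialOrder α] [Fintype α] {k : ℕ} (hk : 2 ≤ k)
    (hexc : ¬ Nonempty (TwoChains k ↪o α)) (c : Fin (pheight α) ↪o α) {i : ℕ}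
    (hi : i ≤ pheight α) :
    heightSet (chainSlab c i) ≤ 4 * k - 4 := by
  refine heightSet_le fun t htS ht => ?_
  have excl : ∀ s : Finset α, s ⊆ t → ∀ m : ℕ, m + k ≤ pheight α →
      (∀ x ∈ s, ∀ j : Fin (pheight α), m ≤ j.1 → j.1 < m + k → ¬ x ≤ c j ∧ ¬ c j ≤ x) →
      s.card ≤ k - 1 := by
    intro s hst m hm hs
    by_contra hcard
    have hs_chain : IsChain (· ≤ ·) (s : Set α) := fun x hx y hy => ht (hst hx) (hst hy)
    obtain ⟨f, hf⟩ := hs_chain.exists_orderEmbedding_fin (show k ≤ s.card by omega)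
    let g : Fin k ↪o Fin (pheight α) :=
      OrderEmbedding.ofMapLEIff (fun j => ⟨m + j.1, by omega⟩) fun _ _ =>
        Nat.add_le_add_iff_left
    exact hexc (nonempty_twoChains_orderEmbedding f (g.trans c) fun a b =>
      hs (f a) (hf a) (g b) (Nat.le_add_right m b) (Nat.add_lt_add_left b.2 m))
  let A₁ := t.filter fun x => ∃ j : Fin (pheight α), j.1 + k ≤ i ∧ ¬ c j ≤ x
  let A₂ := t.filter fun x => ∃ j : Fin (pheight α), i + k ≤ j.1 + 1 ∧ ¬ x ≤ c j
  let A₃ := t.filter fun x => (∀ j : Fin (pheight α), j.1 + k ≤ i → c j ≤ x) ∧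
    ∀ j : Fin (pheight α), i + k ≤ j.1 + 1 → x ≤ c j
  have hcover : t ⊆ A₁ ∪ A₂ ∪ A₃ := by
    intro x hx
    simp only [A₁, A₂, A₃, Finset.mem_union, Finset.mem_filter, hx, true_and]
    by_contra! H
    obtain ⟨⟨h1, h2⟩, h3⟩ := H
    obtain ⟨j, hj, hn⟩ := h3 h1
    exact hn (h2 j hj)
  have hA₁ : A₁.card ≤ k - 1 := by
    rcases A₁.eq_empty_or_nonempty with h0 | ⟨x, hx⟩
    · simp [h0]
    obtain ⟨-, j, hj, -⟩ := Finset.mem_filter.1 hx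
    refine excl A₁ (Finset.filter_subset _ _) (i - k) (by omega) fun x hx j' h1 h2 => ?_
    obtain ⟨hxt, j, hj, hn⟩ := Finset.mem_filter.1 hx
    exact ⟨(htS hxt).1 j' (by omega),
      fun H => hn ((c.monotone (show j.1 ≤ j'.1 by omega)).trans H)⟩
  have hA₂ : A₂.card ≤ k - 1 := by
    rcases A₂.eq_empty_or_nonempty with h0 | ⟨x, hx⟩
    · simp [h0]
    obtain ⟨-, j, hj, -⟩ := Finset.mem_filter.1 hx
    refine excl A₂ (Finset.filter_subset _ _) i (by omega) fun x hx j' h1 h2 => ?_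
    obtain ⟨hxt, j, hj, hn⟩ := Finset.mem_filter.1 hx
    have hxj : ¬ x ≤ c j' := fun H => hn (H.trans (c.monotone (show j'.1 ≤ j.1 by omega)))
    exact ⟨hxj, fun H => (htS hxt).2 j' h1 (H.lt_of_not_ge hxj)⟩
  have hA₃ : A₃.card ≤ 2 * k - 2 := by
    let J : Finset (Fin (pheight α)) := Finset.univ.filter fun j => j.1 + k ≤ i ∨ i + k ≤ j.1 + 1
    have hcmp : ∀ x ∈ A₃, ∀ j ∈ J, c j < x ∨ x < c j := by
      intro x hx j hj
      obtain ⟨hxt, h1, h2⟩ := Finset.mem_filter.1 hx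
      rcases (Finset.mem_filter.1 hj).2 with hj | hj
      · exact Or.inl ((h1 j hj).lt_of_not_ge ((htS hxt).1 j (by omega)))
      · refine Or.inr ((h2 j hj).lt_of_ne ?_)
        rintro rfl
        exact (htS hxt).2 ⟨i, by omega⟩ le_rfl (c.strictMono (show i < j.1 by omega))
    have hdisj : Disjoint A₃ (J.map c.toEmbedding) := by
      rw [Finset.disjoint_left]
      intro x hx hxJ
      obtain ⟨j, hj, rfl⟩ := Finset.mem_map.1 hxJ
      exact (hcmp _ hx j hj).elim (lt_irrefl _) (lt_irrefl _)
    have hchain : IsChain (· ≤ ·) ((A₃ ∪ J.map c.toEmbedding : Finset α) : Set α) := by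
      intro x hx y hy hne
      rcases Finset.mem_union.1 hx with hx | hx <;> rcases Finset.mem_union.1 hy with hy | hy
      · exact ht (Finset.filter_subset _ _ hx) (Finset.filter_subset _ _ hy) hne
      · obtain ⟨j, hj, rfl⟩ := Finset.mem_map.1 hy
        exact (hcmp x hx j hj).symm.imp le_of_lt le_of_lt
      · obtain ⟨j, hj, rfl⟩ := Finset.mem_map.1 hx
        exact (hcmp y hy j hj).imp le_of_lt le_of_lt
      · obtain ⟨j, -, rfl⟩ := Finset.mem_map.1 hx
        obtain ⟨j', -, rfl⟩ := Finset.mem_map.1 hy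
        exact (le_total j j').imp (fun h => c.monotone h) fun h => c.monotone h
    have hle : A₃.card + J.card ≤ pheight α := by
      have := card_le_heightSet (Set.subset_univ _) hchain
      rwa [Finset.card_union_of_disjoint hdisj, Finset.card_map] at this
    have hJ : Jᶜ.card ≤ 2 * k - 2 := by
      have hsub : Jᶜ.map Fin.valEmbedding ⊆ Finset.Ico (i + 1 - k) (i + k - 1) := by
        intro n hn
        obtain ⟨j, hj, rfl⟩ := Finset.mem_map.1 hn
        simp only [J, Finset.mem_compl, Finset.mem_filter, Finset.mem_univ, true_and] at hj
        simp only [Fin.valEmbedding_apply, Finset.mem_Ico]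
        omega
      have := Finset.card_le_card hsub
      rw [Finset.card_map, Nat.card_Ico] at this
      omega
    have := J.card_add_card_compl
    rw [Fintype.card_fin] at this
    omega
  have h1 := Finset.card_le_card hcover
  have h2 := Finset.card_union_le (A₁ ∪ A₂) A₃
  have h3 := Finset.card_union_le A₁ A₂
  omega

/-- If `P` excludes `k + k` and every convex subposet of height at most `4k − 4` has
dimension at most `d_1`, then `dim(P) ≤ (h + 1) d_1` where `h` is the height of `P`. -/
theorem dim_le_height_mul {α : Type*} [PartialOrder α] [Fintype α] (k d1 : ℕ) (hk : 2 ≤ k)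
    (hexc : ¬ Nonempty (TwoChains k ↪o α))
    (hconv : ∀ Q : Set α, Q.OrdConnected → heightSet Q ≤ 4 * k - 4 → pdim ↥Q ≤ d1) :
    pdim α ≤ (pheight α + 1) * d1 := by
  obtain ⟨t, -, ht, hcard⟩ := exists_chain_card_eq_heightSet (Set.univ : Set α)
  obtain ⟨c, -⟩ := ht.exists_orderEmbedding_fin (n := pheight α) hcard.ge
  have hdim : ∀ i : Fin (pheight α + 1), pdim (chainSlab c i) ≤ d1 := fun i =>
    hconv _ (ordConnected_chainSlab c i)
      (heightSet_chainSlab_le hk hexc c (Nat.le_of_lt_succ i.2))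
  have hd1 : 0 < d1 := (pdim_spec (chainSlab c 0)).1.trans_le (hdim 0)
  have : NeZero d1 := ⟨hd1.ne'⟩
  choose L hL hLr using fun i => exists_isLinExt_of_pdim_le (hdim i)
  have key := pdim_le_card (ι := Fin (pheight α + 1) × Fin d1) (fun p => L p.1 p.2)
    (fun p => hL p.1 p.2) fun x y hxy => by
      by_cases hyx : y ≤ x
      · exact ⟨(0, 0), (hL 0 0).not_rel ((hL 0 0).2 y x hyx) fun h => hxy h.le⟩
      · obtain ⟨i, hi, hx, hy⟩ := exists_mem_chainSlab c hxy hyx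
        obtain ⟨j, hj⟩ := hLr ⟨i, Nat.lt_succ_of_le hi⟩ x hx y hy hxy
        exact ⟨(⟨i, Nat.lt_succ_of_le hi⟩, j), hj⟩
  simpa using key
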